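/- Let K and ΔK be symmetric (m+n)×(m+n) real matrices, let ε ≥ 0, and let L̃ be an (m+n)×(m+n) lower triangular real matrix with positive diagonal entries such that K + ΔK = L̃·J_{m+n}·L̃ᵀ, |ΔK| ≤ ε·|L̃|·|L̃ᵀ| entrywise, and cond_F(L̃) · cond_F(L̃⁻ᵀ) · ε < 1/2. If ΔL is a matrix such that L̃ − ΔL is lower triangular with positive diagonal entries and K = (L̃ − ΔL)·J_{m+n}·(L̃ − ΔL)ᵀ, then for every (m+n)×(m+n) diagonal matrix D with positive diagonal entries, ‖ΔL‖_F ≤ (2 + √2) · ‖L̃·D⁻¹‖₂ · ‖D·|L̃⁻¹|·|L̃|‖₂ · cond_F(L̃) · ε. -/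

import Mathlib

open Matrix

noncomputable def frobNorm {k : ℕ} (A : Matrix (Fin k) (Fin k) ℝ) : ℝ :=
  Real.sqrt (∑ i, ∑ j, (A i j) ^ 2)

noncomputable def specNorm {k : ℕ} (A : Matrix (Fin k) (Fin k) ℝ) : ℝ :=
  ‖Matrix.toEuclideanCLM (𝕜 := ℝ) A‖

noncomputable def kappa2 {k : ℕ} (A : Matrix (Fin k) (Fin k) ℝ) : ℝ :=
  specNorm A⁻¹ * specNorm A

noncomputable def upTri {k : ℕ} (A : Matrix (Fin k) (Fin k) ℝ) : Matrix (Fin k) (Fin k) ℝ :=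
  Matrix.of fun i j => if i < j then A i j else if i = j then A i i / 2 else 0

noncomputable def Jmat (m n : ℕ) : Matrix (Fin (m + n)) (Fin (m + n)) ℝ :=
  Matrix.diagonal fun i => if (i : ℕ) < m then 1 else -1

def IsLowerTri {k : ℕ} (A : Matrix (Fin k) (Fin k) ℝ) : Prop :=
  ∀ i j, i < j → A i j = 0

def IsUpperTri {k : ℕ} (A : Matrix (Fin k) (Fin k) ℝ) : Prop :=
  ∀ i j, j < i → A i j = 0

def PosDiag {k : ℕ} (A : Matrix (Fin k) (Fin k) ℝ) : Prop :=
  ∀ i, 0 < A i i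

noncomputable def entAbs {k : ℕ} (A : Matrix (Fin k) (Fin k) ℝ) : Matrix (Fin k) (Fin k) ℝ :=
  Matrix.of fun i j => |A i j|

noncomputable def condF {k : ℕ} (A : Matrix (Fin k) (Fin k) ℝ) : ℝ :=
  frobNorm (entAbs A⁻¹ * entAbs A)

section FrobeniusNorm

variable {k : ℕ}

open scoped Matrix.Norms.Frobenius in
theorem frobNorm_eq_norm (A : Matrix (Fin k) (Fin k) ℝ) : frobNorm A = ‖A‖ := by
  rw [Matrix.frobenius_norm_def, frobNorm, Real.sqrt_eq_rpow]
  simp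

theorem frobNorm_nonneg (A : Matrix (Fin k) (Fin k) ℝ) : 0 ≤ frobNorm A :=
  Real.sqrt_nonneg _

theorem frobNorm_sq (A : Matrix (Fin k) (Fin k) ℝ) :
    frobNorm A ^ 2 = ∑ i, ∑ j, A i j ^ 2 :=
  Real.sq_sqrt (Finset.sum_nonneg fun _ _ => Finset.sum_nonneg fun _ _ => sq_nonneg _)

open scoped Matrix.Norms.Frobenius in
theorem frobNorm_add_le (A B : Matrix (Fin k) (Fin k) ℝ) :
    frobNorm (A + B) ≤ frobNorm A + frobNorm B := by
  simpa only [frobNorm_eq_norm] using norm_add_le A B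

open scoped Matrix.Norms.Frobenius in
theorem frobNorm_mul_le (A B : Matrix (Fin k) (Fin k) ℝ) :
    frobNorm (A * B) ≤ frobNorm A * frobNorm B := by
  simpa only [frobNorm_eq_norm] using Matrix.frobenius_norm_mul A B

theorem frobNorm_transpose (A : Matrix (Fin k) (Fin k) ℝ) : frobNorm Aᵀ = frobNorm A := by
  unfold frobNorm
  rw [Finset.sum_comm]
  rfl

theorem frobNorm_le_of_abs_le {A B : Matrix (Fin k) (Fin k) ℝ}
    (h : ∀ i j, |A i j| ≤ |B i j|) : frobNorm A ≤ frobNorm B :=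
  Real.sqrt_le_sqrt <| Finset.sum_le_sum fun i _ => Finset.sum_le_sum fun j _ =>
    sq_le_sq.mpr (h i j)

theorem frobNorm_smul {c : ℝ} (hc : 0 ≤ c) (A : Matrix (Fin k) (Fin k) ℝ) :
    frobNorm (c • A) = c * frobNorm A := by
  unfold frobNorm
  simp only [Matrix.smul_apply, smul_eq_mul, mul_pow, ← Finset.mul_sum]
  rw [Real.sqrt_mul (sq_nonneg c), Real.sqrt_sq hc]

theorem frobNorm_mul_diagonal {d : Fin k → ℝ} (hd : ∀ i, d i ^ 2 = 1)
    (A : Matrix (Fin k) (Fin k) ℝ) : frobNorm (A * diagonal d) = frobNorm A := by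
  simp [frobNorm, mul_pow, hd]

theorem frobNorm_mul_le_specNorm_mul (A B : Matrix (Fin k) (Fin k) ℝ) :
    frobNorm (A * B) ≤ specNorm A * frobNorm B := by
  have hs : 0 ≤ specNorm A := norm_nonneg _
  refine le_of_sq_le_sq ?_ (mul_nonneg hs (frobNorm_nonneg B))
  rw [mul_pow, frobNorm_sq, frobNorm_sq, Finset.sum_comm,
    Finset.sum_comm (f := fun i j => B i j ^ 2), Finset.mul_sum]
  refine Finset.sum_le_sum fun j _ => ?_
  have h := (Matrix.toEuclideanCLM (𝕜 := ℝ) A).le_opNorm (WithLp.toLp 2 fun i => B i j)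
  have h2 := pow_le_pow_left₀ (norm_nonneg _) h 2
  rw [mul_pow, EuclideanSpace.norm_sq_eq, EuclideanSpace.norm_sq_eq] at h2
  simpa [specNorm, Matrix.mulVec, dotProduct, Matrix.mul_apply] using h2

end FrobeniusNorm

section EntrywiseAbs

variable {k : ℕ}

theorem abs_mul_apply_le {A B A' B' : Matrix (Fin k) (Fin k) ℝ}
    (hA : ∀ i j, |A i j| ≤ A' i j) (hB : ∀ i j, |B i j| ≤ B' i j) (i j : Fin k) :
    |(A * B) i j| ≤ (A' * B') i j := by
  simp only [Matrix.mul_apply]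
  refine (Finset.abs_sum_le_sum_abs _ _).trans (Finset.sum_le_sum fun l _ => ?_)
  rw [abs_mul]
  exact mul_le_mul (hA i l) (hB l j) (abs_nonneg _) ((abs_nonneg _).trans (hA i l))

theorem entAbs_transpose (A : Matrix (Fin k) (Fin k) ℝ) : entAbs Aᵀ = (entAbs A)ᵀ := rfl

theorem condF_inv_transpose {A : Matrix (Fin k) (Fin k) ℝ} (hA : IsUnit A.det) :
    condF (A⁻¹ᵀ) = condF A := by
  rw [condF, condF, ← Matrix.transpose_nonsing_inv, Matrix.nonsing_inv_nonsing_inv _ hA,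
    entAbs_transpose, entAbs_transpose, ← Matrix.transpose_mul, frobNorm_transpose]

end EntrywiseAbs

section Triangular

variable {k : ℕ}

theorem IsLowerTri.isUnit_det {A : Matrix (Fin k) (Fin k) ℝ} (hA : IsLowerTri A)
    (hpos : PosDiag A) : IsUnit A.det := by
  rw [Matrix.det_of_isLowerTriangular A fun i j h => hA i j h]
  exact (Finset.prod_pos fun i _ => hpos i).ne'.isUnit

theorem IsLowerTri.mul {A B : Matrix (Fin k) (Fin k) ℝ} (hA : IsLowerTri A)
    (hB : IsLowerTri B) : IsLowerTri (A * B) := by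
  intro i j hij
  rw [Matrix.mul_apply]
  refine Finset.sum_eq_zero fun l _ => ?_
  rcases lt_or_ge i l with h | h
  · rw [hA i l h, zero_mul]
  · rw [hB l j (h.trans_lt hij), mul_zero]

theorem IsLowerTri.inv {A : Matrix (Fin k) (Fin k) ℝ} (hA : IsLowerTri A)
    (hpos : PosDiag A) : IsLowerTri A⁻¹ := by
  have : Invertible A := A.invertibleOfIsUnitDet (hA.isUnit_det hpos)
  have h : A.BlockTriangular OrderDual.toDual := fun i j h => hA i j h
  exact fun i j hij => Matrix.blockTriangular_inv_of_blockTriangular h hij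

theorem IsLowerTri.apply_self_mul {A B : Matrix (Fin k) (Fin k) ℝ} (hA : IsLowerTri A)
    (hB : IsLowerTri B) (i : Fin k) : (A * B) i i = A i i * B i i := by
  rw [Matrix.mul_apply]
  refine Finset.sum_eq_single i (fun l _ hl => ?_) (by simp)
  rcases lt_or_gt_of_ne hl with h | h
  · rw [hB l i h, mul_zero]
  · rw [hA i l h, zero_mul]

theorem IsLowerTri.mul_diagonal {A : Matrix (Fin k) (Fin k) ℝ} (hA : IsLowerTri A)
    (d : Fin k → ℝ) : IsLowerTri (A * diagonal d) := by
  intro i j hij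
  rw [Matrix.mul_diagonal, hA i j hij, zero_mul]

theorem IsLowerTri.two_mul_frobNorm_sq_le {Y : Matrix (Fin k) (Fin k) ℝ} (hY : IsLowerTri Y) :
    2 * frobNorm Y ^ 2 ≤ frobNorm (Y + Yᵀ) ^ 2 := by
  have h : 2 * frobNorm Y ^ 2 = frobNorm Y ^ 2 + frobNorm Yᵀ ^ 2 := by
    rw [frobNorm_transpose]; ring
  rw [h]
  simp only [frobNorm_sq, ← Finset.sum_add_distrib]
  refine Finset.sum_le_sum fun i _ => Finset.sum_le_sum fun j _ => ?_
  have : 0 ≤ Y i j * Y j i := by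
    rcases lt_trichotomy i j with h | rfl | h
    · rw [hY i j h, zero_mul]
    · exact mul_self_nonneg _
    · rw [hY j i h, mul_zero]
  simp only [Matrix.add_apply, Matrix.transpose_apply]
  nlinarith

theorem IsLowerTri.abs_apply_le {Y : Matrix (Fin k) (Fin k) ℝ} (hY : IsLowerTri Y)
    (i j : Fin k) : |Y i j| ≤ |(Y + Yᵀ) i j| := by
  simp only [Matrix.add_apply, Matrix.transpose_apply]
  rcases lt_trichotomy i j with h | rfl | h
  · rw [hY i j h, abs_zero]
    exact abs_nonneg _
  · rw [← two_mul, abs_mul, abs_two]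
    linarith [abs_nonneg (Y i i)]
  · rw [hY j i h, add_zero]

end Triangular

section Signature

variable {k : ℕ} {d : Fin k → ℝ}

theorem diagonal_mul_self_of_sq_eq_one (hd : ∀ i, d i ^ 2 = 1) :
    diagonal d * diagonal d = 1 := by
  rw [Matrix.diagonal_mul_diagonal, ← Matrix.diagonal_one]
  exact congrArg diagonal (funext fun i => by rw [← sq, hd])

/-- Rewriting of the residual `J - T J Tᵀ` in terms of `Y = (1 - T) J`. -/
theorem add_transpose_eq_residual_add (hd : ∀ i, d i ^ 2 = 1)
    {T Y : Matrix (Fin k) (Fin k) ℝ} (hY : Y = (1 - T) * diagonal d) :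
    Y + Yᵀ = (diagonal d - T * diagonal d * Tᵀ) + Y * diagonal d * Yᵀ := by
  have hJ := diagonal_mul_self_of_sq_eq_one hd
  have h1 : Y * diagonal d = 1 - T := by rw [hY, Matrix.mul_assoc, hJ, Matrix.mul_one]
  rw [h1, hY]
  simp only [Matrix.transpose_mul, Matrix.diagonal_transpose, Matrix.transpose_sub,
    Matrix.transpose_one]
  noncomm_ring

theorem frobNorm_one_sub_sq_ne_half (hd : ∀ i, d i ^ 2 = 1) {T : Matrix (Fin k) (Fin k) ℝ}
    (hT : IsLowerTri T) (hE : frobNorm (diagonal d - T * diagonal d * Tᵀ) < 1 / 2) :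
    frobNorm (1 - T) ^ 2 ≠ 1 / 2 := by
  intro hx
  set Y := (1 - T) * diagonal d with hYdef
  have hlow : IsLowerTri (1 - T) := fun i j hij => by
    rw [Matrix.sub_apply, hT i j hij, Matrix.one_apply_ne hij.ne, sub_zero]
  have hY : IsLowerTri Y := hlow.mul_diagonal d
  have hYx : frobNorm Y ^ 2 = 1 / 2 := by rw [frobNorm_mul_diagonal hd, hx]
  have h1 := hY.two_mul_frobNorm_sq_le
  rw [add_transpose_eq_residual_add hd hYdef] at h1
  have h2 := frobNorm_add_le (diagonal d - T * diagonal d * Tᵀ) (Y * diagonal d * Yᵀ)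
  have h3 := frobNorm_mul_le (Y * diagonal d) Yᵀ
  rw [frobNorm_mul_diagonal hd, frobNorm_transpose] at h3
  have h4 := frobNorm_nonneg (diagonal d - T * diagonal d * Tᵀ + Y * diagonal d * Yᵀ)
  nlinarith

/-- Rows before `p` agree with `T`, rows after `p` with the identity; row `p` is interpolated so
that the square of its diagonal entry is affine in `t ^ 2`. -/
noncomputable def rowPath (T : Matrix (Fin k) (Fin k) ℝ) (p : ℕ) (t : ℝ) :
    Matrix (Fin k) (Fin k) ℝ :=
  Matrix.of fun i j =>
    if (i : ℕ) < p then T i j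
    else if (i : ℕ) = p then
      if i = j then Real.sqrt (1 - t ^ 2 + t ^ 2 * T i i ^ 2) else t * T i j
    else (1 : Matrix (Fin k) (Fin k) ℝ) i j

theorem IsLowerTri.rowPath {T : Matrix (Fin k) (Fin k) ℝ} (hT : IsLowerTri T) (p : ℕ) (t : ℝ) :
    IsLowerTri (rowPath T p t) := by
  intro i j hij
  simp [_root_.rowPath, hT i j hij, hij.ne, Matrix.one_apply_ne hij.ne]

theorem rowPath_zero_zero (T : Matrix (Fin k) (Fin k) ℝ) : rowPath T 0 0 = 1 := by
  ext i j
  simp only [rowPath, Matrix.of_apply, Matrix.one_apply]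
  split_ifs <;> simp_all

theorem rowPath_succ_zero {T : Matrix (Fin k) (Fin k) ℝ} (hpos : PosDiag T) (p : ℕ) :
    rowPath T (p + 1) 0 = rowPath T p 1 := by
  ext i j
  simp only [rowPath, Matrix.of_apply, Matrix.one_apply]
  rcases lt_trichotomy (i : ℕ) p with h | h | h
  · simp [h, Nat.lt_succ_of_lt h]
  · by_cases hij : i = j
    · subst hij
      simp [h, Real.sqrt_sq (hpos i).le]
    · simp [h, hij]
  · have h1 : ¬ (i : ℕ) < p := by omega
    have h2 : ¬ (i : ℕ) < p + 1 := by omega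
    simp [h1, h2, h.ne']

theorem rowPath_eq_self {T : Matrix (Fin k) (Fin k) ℝ} : rowPath T k 0 = T := by
  ext i j
  simp [rowPath]

theorem continuous_frobNorm_one_sub_rowPath_sq (T : Matrix (Fin k) (Fin k) ℝ) (p : ℕ) :
    Continuous fun t => frobNorm (1 - rowPath T p t) ^ 2 := by
  simp only [frobNorm_sq]
  refine continuous_finsetSum _ fun i _ => continuous_finsetSum _ fun j _ => ?_
  simp only [rowPath, Matrix.sub_apply, Matrix.of_apply]
  split_ifs <;> fun_prop

theorem residual_apply (T : Matrix (Fin k) (Fin k) ℝ) (i j : Fin k) :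
    (diagonal d - T * diagonal d * Tᵀ) i j =
      diagonal d i j - ∑ l, T i l * d l * T j l := by
  simp only [Matrix.sub_apply, Matrix.mul_apply (N := Tᵀ), Matrix.mul_diagonal,
    Matrix.transpose_apply]

theorem residual_apply_comm (T : Matrix (Fin k) (Fin k) ℝ) (i j : Fin k) :
    (diagonal d - T * diagonal d * Tᵀ) i j = (diagonal d - T * diagonal d * Tᵀ) j i := by
  rw [residual_apply, residual_apply, Matrix.diagonal_apply, Matrix.diagonal_apply]
  congr 1
  · by_cases h : i = j
    · simp [h]
    · simp [h, Ne.symm h]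
  · exact Finset.sum_congr rfl fun l _ => by ring

theorem abs_residual_rowPath_le {T : Matrix (Fin k) (Fin k) ℝ} (hT : IsLowerTri T) (p : ℕ)
    {t : ℝ} (ht : t ∈ Set.Icc (0 : ℝ) 1) (i j : Fin k) :
    |(diagonal d - rowPath T p t * diagonal d * (rowPath T p t)ᵀ) i j| ≤
      |(diagonal d - T * diagonal d * Tᵀ) i j| := by
  wlog hij : i ≤ j generalizing i j
  · rw [residual_apply_comm, residual_apply_comm T]
    exact this j i (le_of_not_ge hij)
  obtain ⟨ht0, ht1⟩ := ht
  have hsq : t ^ 2 ≤ 1 := pow_le_one₀ ht0 ht1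
  rcases lt_trichotomy (j : ℕ) p with hj | hj | hj
  · have hi : (i : ℕ) < p := lt_of_le_of_lt hij hj
    rw [residual_apply, residual_apply]
    simp [rowPath, hi, hj]
  · rcases hij.lt_or_eq with hlt | rfl
    · have hi : (i : ℕ) < p := hj ▸ hlt
      have : (diagonal d - rowPath T p t * diagonal d * (rowPath T p t)ᵀ) i j =
          t * (diagonal d - T * diagonal d * Tᵀ) i j := by
        rw [residual_apply, residual_apply, Matrix.diagonal_apply_ne _ hlt.ne, mul_sub,
          Finset.mul_sum, mul_zero]
        congr 1
        refine Finset.sum_congr rfl fun l _ => ?_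
        by_cases hl : j = l
        · subst hl
          simp [rowPath, hi, hT i j hlt]
        · simp only [rowPath, Matrix.of_apply, hi, hj, hl, if_true, if_false, lt_irrefl]
          ring
      rw [this, abs_mul, abs_of_nonneg ht0]
      exact mul_le_of_le_one_left (abs_nonneg _) ht1
    · have : (diagonal d - rowPath T p t * diagonal d * (rowPath T p t)ᵀ) i i =
          t ^ 2 * (diagonal d - T * diagonal d * Tᵀ) i i := by
        have hterm : ∀ l, rowPath T p t i l * d l * rowPath T p t i l =
            t ^ 2 * (T i l * d l * T i l) + if i = l then (1 - t ^ 2) * d i else 0 := by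
          intro l
          by_cases hl : i = l
          · subst hl
            have hr : 0 ≤ 1 - t ^ 2 + t ^ 2 * T i i ^ 2 := by
              nlinarith [mul_nonneg (sq_nonneg t) (sq_nonneg (T i i))]
            simp only [rowPath, Matrix.of_apply, hj, lt_irrefl, if_true, if_false]
            linear_combination d i * Real.mul_self_sqrt hr
          · simp only [rowPath, Matrix.of_apply, hj, hl, lt_irrefl, if_true, if_false]
            ring
        rw [residual_apply, residual_apply, Matrix.diagonal_apply_eq,
          Finset.sum_congr rfl fun l _ => hterm l, Finset.sum_add_distrib, ← Finset.mul_sum,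
          Finset.sum_ite_eq, if_pos (Finset.mem_univ _)]
        ring
      rw [this, abs_mul, abs_of_nonneg (sq_nonneg t)]
      exact mul_le_of_le_one_left (abs_nonneg _) hsq
  · have hrow : ∀ l, rowPath T p t j l = (1 : Matrix (Fin k) (Fin k) ℝ) j l := fun l => by
      simp [rowPath, hj.ne', hj.le]
    have : (diagonal d - rowPath T p t * diagonal d * (rowPath T p t)ᵀ) i j = 0 := by
      rw [residual_apply]
      simp only [hrow, Matrix.one_apply, mul_ite, mul_one, mul_zero, Finset.sum_ite_eq,
        Finset.mem_univ, if_true]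
      rcases hij.lt_or_eq with hlt | rfl
      · rw [Matrix.diagonal_apply_ne _ hlt.ne, hT.rowPath p t i j hlt, zero_mul, sub_zero]
      · simp [hrow]
    rw [this, abs_zero]
    exact abs_nonneg _

/-- A lower triangular `T` with positive diagonal and `T J Tᵀ` close to `J` is close to `1`. -/
theorem frobNorm_one_sub_sq_lt_half (hd : ∀ i, d i ^ 2 = 1) {T : Matrix (Fin k) (Fin k) ℝ}
    (hT : IsLowerTri T) (hpos : PosDiag T)
    (hE : frobNorm (diagonal d - T * diagonal d * Tᵀ) < 1 / 2) :
    frobNorm (1 - T) ^ 2 < 1 / 2 := by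
  have key : ∀ p, frobNorm (1 - rowPath T p 0) ^ 2 < 1 / 2 := by
    intro p
    induction p with
    | zero => simp [rowPath_zero_zero, frobNorm]
    | succ p ih =>
      rw [rowPath_succ_zero hpos]
      by_contra! hge
      obtain ⟨t, ht, hft⟩ := intermediate_value_Icc zero_le_one
        (continuous_frobNorm_one_sub_rowPath_sq T p).continuousOn ⟨ih.le, hge⟩
      exact frobNorm_one_sub_sq_ne_half hd (hT.rowPath p t)
        ((frobNorm_le_of_abs_le (abs_residual_rowPath_le hT p ht)).trans_lt hE) hft
  simpa only [rowPath_eq_self] using key k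

/-- Row-scaled bound for `1 - T` by the residual `J - T J Tᵀ`. -/
theorem frobNorm_diagonal_mul_one_sub_le (hd : ∀ i, d i ^ 2 = 1)
    {T : Matrix (Fin k) (Fin k) ℝ} (hT : IsLowerTri T) (hpos : PosDiag T)
    (hE : frobNorm (diagonal d - T * diagonal d * Tᵀ) < 1 / 2) (w : Fin k → ℝ) :
    frobNorm (diagonal w * (1 - T)) ≤
      (2 + Real.sqrt 2) * frobNorm (diagonal w * (diagonal d - T * diagonal d * Tᵀ)) := by
  have hx := frobNorm_one_sub_sq_lt_half hd hT hpos hE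
  set Y := (1 - T) * diagonal d with hYdef
  set E := diagonal d - T * diagonal d * Tᵀ with hEdef
  have hlow : IsLowerTri (1 - T) := fun i j hij => by
    rw [Matrix.sub_apply, hT i j hij, Matrix.one_apply_ne hij.ne, sub_zero]
  have hY : IsLowerTri Y := hlow.mul_diagonal d
  have hYx : frobNorm Y = frobNorm (1 - T) := frobNorm_mul_diagonal hd _
  have hwY : frobNorm (diagonal w * Y) = frobNorm (diagonal w * (1 - T)) := by
    rw [hYdef, ← Matrix.mul_assoc, frobNorm_mul_diagonal hd]
  have h1 : frobNorm (diagonal w * Y) ≤ frobNorm (diagonal w * (Y + Yᵀ)) := by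
    refine frobNorm_le_of_abs_le fun i j => ?_
    rw [Matrix.diagonal_mul, Matrix.diagonal_mul, abs_mul, abs_mul]
    exact mul_le_mul_of_nonneg_left (hY.abs_apply_le i j) (abs_nonneg _)
  rw [add_transpose_eq_residual_add hd hYdef, Matrix.mul_add] at h1
  have h2 := frobNorm_add_le (diagonal w * E) (diagonal w * (Y * diagonal d * Yᵀ))
  have h3 := frobNorm_mul_le (diagonal w * Y * diagonal d) Yᵀ
  rw [frobNorm_mul_diagonal hd, frobNorm_transpose, Matrix.mul_assoc, Matrix.mul_assoc,
    ← Matrix.mul_assoc Y] at h3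
  rw [← hwY]
  rw [← hYx] at hx
  set a := frobNorm (diagonal w * Y)
  set x := frobNorm Y
  have ha : 0 ≤ a := frobNorm_nonneg _
  have hs : Real.sqrt 2 ^ 2 = 2 := Real.sq_sqrt zero_le_two
  have hs0 : 0 ≤ Real.sqrt 2 := Real.sqrt_nonneg 2
  have hx' : x ≤ Real.sqrt 2 / 2 :=
    le_of_sq_le_sq (by rw [div_pow, hs]; linarith) (by positivity)
  have h4 : a * (1 - Real.sqrt 2 / 2) ≤ frobNorm (diagonal w * E) := by
    nlinarith [mul_le_mul_of_nonneg_left hx' ha]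
  calc a = (2 + Real.sqrt 2) * (a * (1 - Real.sqrt 2 / 2)) := by
        linear_combination (a / 2) * hs
    _ ≤ _ := mul_le_mul_of_nonneg_left h4 (by positivity)

end Signature

theorem stmt17 (m n : ℕ) (K dK Lt dL D : Matrix (Fin (m + n)) (Fin (m + n)) ℝ) (ε : ℝ)
    (hK : Kᵀ = K) (hdK : dKᵀ = dK) (hε : 0 ≤ ε)
    (hLt : IsLowerTri Lt) (hLtd : PosDiag Lt)
    (hfact : K + dK = Lt * Jmat m n * Ltᵀ)
    (hbound : ∀ i j, |dK i j| ≤ ε * (entAbs Lt * entAbs Ltᵀ) i j)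
    (hsmall : condF Lt * condF (Lt⁻¹ᵀ) * ε < 1 / 2)
    (hL' : IsLowerTri (Lt - dL)) (hL'd : PosDiag (Lt - dL))
    (hfact' : K = (Lt - dL) * Jmat m n * (Lt - dL)ᵀ)
    (hD : D.IsDiag) (hDpos : ∀ i, 0 < D i i) :
    frobNorm dL ≤
      (2 + Real.sqrt 2) * specNorm (Lt * D⁻¹) * specNorm (D * entAbs Lt⁻¹ * entAbs Lt) *
        condF Lt * ε := by
  have hdet := hLt.isUnit_det hLtd
  have hinv := hLt.inv hLtd
  have hLL : Lt⁻¹ * Lt = 1 := Matrix.nonsing_inv_mul _ hdet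
  have hLL' : Lt * Lt⁻¹ = 1 := Matrix.mul_nonsing_inv _ hdet
  rw [condF_inv_transpose hdet] at hsmall
  set d : Fin (m + n) → ℝ := fun i => if (i : ℕ) < m then 1 else -1 with hd_def
  have hJ : Jmat m n = diagonal d := rfl
  have hd : ∀ i, d i ^ 2 = 1 := fun i => by
    simp only [hd_def]
    split_ifs <;> norm_num
  rw [hJ] at hfact hfact'
  set T := Lt⁻¹ * (Lt - dL) with hT_def
  have hT : IsLowerTri T := hinv.mul hL'
  have hinvpos : ∀ i, 0 < Lt⁻¹ i i := fun i => by
    have h := hinv.apply_self_mul hLt i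
    rw [hLL, Matrix.one_apply_eq] at h
    exact pos_of_mul_pos_left (h ▸ one_pos) (hLtd i).le
  have hTpos : PosDiag T := fun i => by
    rw [hT_def, hinv.apply_self_mul hL']
    exact mul_pos (hinvpos i) (hL'd i)
  have hX : 1 - T = Lt⁻¹ * dL := by
    rw [hT_def, Matrix.mul_sub, hLL]
    abel
  have hLt_T : Lt - dL = Lt * T := by rw [hT_def, ← Matrix.mul_assoc, hLL', Matrix.one_mul]
  have hE : diagonal d - T * diagonal d * Tᵀ = Lt⁻¹ * dK * (Lt⁻¹)ᵀ := by
    have h1 : dK = Lt * diagonal d * Ltᵀ - (Lt - dL) * diagonal d * (Lt - dL)ᵀ := by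
      rw [← hfact, ← hfact', add_sub_cancel_left]
    have h2 : dK = Lt * (diagonal d - T * diagonal d * Tᵀ) * Ltᵀ := by
      rw [h1, hLt_T, Matrix.transpose_mul]
      noncomm_ring
    have h3 : Ltᵀ * (Lt⁻¹)ᵀ = 1 := by
      rw [← Matrix.transpose_mul, hLL, Matrix.transpose_one]
    rw [h2, Matrix.mul_assoc Lt, Matrix.nonsing_inv_mul_cancel_left _ _ hdet,
      Matrix.mul_assoc _ Ltᵀ, h3, Matrix.mul_one]
  set M := entAbs Lt⁻¹ * entAbs Lt with hM
  have hEM : ∀ i j, |(diagonal d - T * diagonal d * Tᵀ) i j| ≤ (ε • (M * Mᵀ)) i j := by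
    have h := abs_mul_apply_le
      (abs_mul_apply_le (A := Lt⁻¹) (A' := entAbs Lt⁻¹) (fun _ _ => le_rfl)
        (B' := ε • (entAbs Lt * entAbs Ltᵀ)) hbound)
      (B := (Lt⁻¹)ᵀ) (B' := (entAbs Lt⁻¹)ᵀ) (fun _ _ => le_rfl)
    have h2 : entAbs Lt⁻¹ * (ε • (entAbs Lt * entAbs Ltᵀ)) * (entAbs Lt⁻¹)ᵀ = ε • (M * Mᵀ) := by
      rw [hM, Matrix.transpose_mul, entAbs_transpose, Matrix.mul_smul, Matrix.smul_mul]
      simp only [Matrix.mul_assoc]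
    rw [hE, ← h2]
    exact h
  have hcond : condF Lt = frobNorm M := rfl
  have hEsmall : frobNorm (diagonal d - T * diagonal d * Tᵀ) < 1 / 2 := by
    refine lt_of_le_of_lt (frobNorm_le_of_abs_le fun i j => (hEM i j).trans (le_abs_self _)) ?_
    rw [frobNorm_smul hε]
    have h := frobNorm_mul_le M Mᵀ
    rw [frobNorm_transpose] at h
    rw [hcond] at hsmall
    nlinarith [mul_le_mul_of_nonneg_left h hε]
  obtain ⟨w, rfl⟩ : ∃ w, D = diagonal w := ⟨D.diag, hD.diagonal_diag.symm⟩
  have hw : ∀ i, 0 < w i := fun i => by simpa using hDpos i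
  have hDE : frobNorm (diagonal w * (diagonal d - T * diagonal d * Tᵀ)) ≤
      ε * (specNorm (diagonal w * M) * frobNorm M) := by
    refine (frobNorm_le_of_abs_le (B := ε • (diagonal w * M * Mᵀ)) fun i j => ?_).trans ?_
    · rw [Matrix.mul_assoc (diagonal w) M, ← Matrix.mul_smul (diagonal w), Matrix.diagonal_mul,
        Matrix.diagonal_mul, abs_mul, abs_mul]
      exact mul_le_mul_of_nonneg_left ((hEM i j).trans (le_abs_self _)) (abs_nonneg _)
    · rw [frobNorm_smul hε]
      have h := frobNorm_mul_le_specNorm_mul (diagonal w * M) Mᵀ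
      rw [frobNorm_transpose] at h
      exact mul_le_mul_of_nonneg_left h hε
  have hdw : IsUnit (diagonal w).det := by
    rw [Matrix.det_diagonal]
    exact (Finset.prod_pos fun i _ => hw i).ne'.isUnit
  have hdL : dL = Lt * (diagonal w)⁻¹ * (diagonal w * (1 - T)) := by
    rw [Matrix.mul_assoc, Matrix.nonsing_inv_mul_cancel_left _ _ hdw, hX, ← Matrix.mul_assoc, hLL',
      Matrix.one_mul]
  have hs : 0 ≤ specNorm (Lt * (diagonal w)⁻¹) := norm_nonneg _
  rw [Matrix.mul_assoc (diagonal w), ← hM, hcond]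
  calc frobNorm dL
      ≤ specNorm (Lt * (diagonal w)⁻¹) * frobNorm (diagonal w * (1 - T)) := by
        conv_lhs => rw [hdL]
        exact frobNorm_mul_le_specNorm_mul _ _
    _ ≤ specNorm (Lt * (diagonal w)⁻¹) *
          ((2 + Real.sqrt 2) * (ε * (specNorm (diagonal w * M) * frobNorm M))) := by
        refine mul_le_mul_of_nonneg_left ?_ hs
        exact (frobNorm_diagonal_mul_one_sub_le hd hT hTpos hEsmall w).trans
          (mul_le_mul_of_nonneg_left hDE (by positivity))
    _ = _ := by ring
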